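/- arXiv:1408.0053 — 2 statements merged into one kernel-verified Lean document; each statement's English description precedes it below -/
import Mathlib

section
/- Let N = (B,E,F) be a locally finite, K-dense causal net with X = B ∪ E. Let A ⊆ X be a closed set (A = A'') and let τ be a B-cut of A (a maximal antichain of A consisting only of conditions). Then A = τ''. -/
/-- A causal net `N = (B, E, F)`: conditions `B` and events `E` are disjoint
countable sets covering the carrier, `F ⊆ (B × E) ∪ (E × B)` is the flow
relation, every element is in `dom F ∪ ran F`, every condition has at most one
`F`-predecessor and at most one `F`-successor, and `F⁺` is irreflexive. -/
structure CausalNet (α : Type*) where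
  B : Set α
  E : Set α
  F : α → α → Prop
  countable_B : B.Countable
  countable_E : E.Countable
  disjoint_BE : Disjoint B E
  cover : B ∪ E = Set.univ
  bipartite : ∀ x y, F x y → (x ∈ B ∧ y ∈ E) ∨ (x ∈ E ∧ y ∈ B)
  no_isolated : ∀ x, (∃ y, F x y) ∨ (∃ y, F y x)
  pred_subsingleton : ∀ b ∈ B, {e | F e b}.Subsingleton
  succ_subsingleton : ∀ b ∈ B, {e | F b e}.Subsingleton
  acyclic : ∀ x, ¬ Relation.TransGen F x x

namespace CausalNet

variable {α : Type*} (N : CausalNet α)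

/-- The causal order `⊑ = F*` (reflexive-transitive closure of `F`). -/
def le (x y : α) : Prop := Relation.ReflTransGen N.F x y

/-- `li = ⊑ ∪ ⊒`: causal relatedness. -/
def li (x y : α) : Prop := N.le x y ∨ N.le y x

/-- `co = (X × X) \ li`: concurrency (causal independence). -/
def co (x y : α) : Prop := ¬ N.li x y

/-- `A' = {x | ∀ y ∈ A, x co y}`, the orthocomplement of `A`. -/
def prime (A : Set α) : Set α := {x | ∀ y ∈ A, N.co x y}

/-- `A` is closed iff `A = A''`. -/
def Closed (A : Set α) : Prop := A = N.prime (N.prime A)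

/-- A line is a maximal clique of `li`. -/
def IsLine (l : Set α) : Prop :=
  l.Pairwise N.li ∧ ∀ m : Set α, m.Pairwise N.li → l ⊆ m → m = l

/-- A cut is a maximal clique of `co ∪ id`, i.e. a maximal antichain. -/
def IsCut (c : Set α) : Prop :=
  c.Pairwise N.co ∧ ∀ m : Set α, m.Pairwise N.co → c ⊆ m → m = c

/-- K-density: every cut meets every line. -/
def KDense : Prop :=
  ∀ c l : Set α, N.IsCut c → N.IsLine l → (c ∩ l).Nonempty

/-- The interval `[x, y] = {z | x ⊑ z ⊑ y}`. -/
def interval (x y : α) : Set α := {z | N.le x z ∧ N.le z y}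

/-- Local finiteness: intervals are finite and every element has finitely many
immediate `F`-predecessors and immediate `F`-successors. -/
def LocallyFinite : Prop :=
  (∀ x y, (N.interval x y).Finite) ∧
  (∀ x, {y | N.F y x}.Finite) ∧ (∀ x, {y | N.F x y}.Finite)

/-- A B-cut of a subset `S`: a maximal antichain of `(S, ⊑)` consisting only of
conditions. -/
def IsBCutOf (S τ : Set α) : Prop :=
  τ ⊆ S ∧ τ ⊆ N.B ∧ τ.Pairwise N.co ∧
  ∀ m : Set α, m ⊆ S → m.Pairwise N.co → τ ⊆ m → m = τ

/-- Preconditions `•e` of an event. -/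
def pre (e : α) : Set α := {b | N.F b e}

/-- Postconditions `e•` of an event. -/
def post (e : α) : Set α := {b | N.F e b}

/-- Causally closed sets (Definition of `CC(N)`). -/
def CausallyClosed (C : Set α) : Prop :=
  (∀ e ∈ N.E, N.pre e ⊆ C → e ∈ C) ∧
  (∀ e ∈ N.E, N.post e ⊆ C → e ∈ C) ∧
  (∀ e ∈ N.E, e ∈ C → N.pre e ∪ N.post e ⊆ C) ∧
  (∀ x ∈ C, ∀ y ∈ C, N.li x y → N.interval x y ⊆ C)

end CausalNet

namespace CausalNet

variable {α : Type*} (N : CausalNet α)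

/-- The net with the flow relation reversed. -/
def reverse : CausalNet α where
  B := N.B
  E := N.E
  F := Function.swap N.F
  countable_B := N.countable_B
  countable_E := N.countable_E
  disjoint_BE := N.disjoint_BE
  cover := N.cover
  bipartite x y h := (N.bipartite y x h).symm.imp And.symm And.symm
  no_isolated x := (N.no_isolated x).symm
  pred_subsingleton := N.succ_subsingleton
  succ_subsingleton := N.pred_subsingleton
  acyclic x h := N.acyclic x (Relation.transGen_swap.1 h)

theorem reverse_le {x y : α} : N.reverse.le x y ↔ N.le y x :=
  Relation.reflTransGen_swap

theorem reverse_co : N.reverse.co = N.co := by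
  ext x y
  simp only [co, li, reverse_le, or_comm]

theorem reverse_prime : N.reverse.prime = N.prime := by
  ext S x
  simp only [prime, reverse_co]

variable {N}

theorem le_refl (x : α) : N.le x x := Relation.ReflTransGen.refl

theorem le_trans {x y z : α} (h : N.le x y) (h' : N.le y z) : N.le x z :=
  Relation.ReflTransGen.trans h h'

theorem le_of_F {x y : α} (h : N.F x y) : N.le x y := Relation.ReflTransGen.single h

theorem co_symm {x y : α} (h : N.co x y) : N.co y x := fun h' => h h'.symm

theorem prime_anti {S T : Set α} (h : S ⊆ T) : N.prime T ⊆ N.prime S :=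
  fun _ hx y hy => hx y (h hy)

theorem Closed.mem_of_le_of_le {A : Set α} (hA : N.Closed A) {x y z : α} (hx : x ∈ A)
    (hz : z ∈ A) (hxy : N.le x y) (hyz : N.le y z) : y ∈ A := by
  rw [hA]
  intro w hw h
  rcases h with h | h
  · exact hw x hx (Or.inr (le_trans hxy h))
  · exact hw z hz (Or.inl (le_trans h hyz))

theorem le_of_F_of_le_condition {b e y : α} (hb : b ∈ N.B) (he : N.F e b) (hy : N.le y b)
    (hne : y ≠ b) : N.le y e := by
  rcases Relation.ReflTransGen.cases_tail hy with h | ⟨c, hc, hcb⟩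
  · exact absurd h.symm hne
  · rwa [N.pred_subsingleton b hb he hcb]

theorem le_of_F_of_condition_le {b e y : α} (hb : b ∈ N.B) (he : N.F b e) (hy : N.le b y)
    (hne : y ≠ b) : N.le e y := by
  rcases Relation.ReflTransGen.cases_head hy with h | ⟨c, hbc, hc⟩
  · exact absurd h.symm hne
  · rwa [N.succ_subsingleton b hb he hbc]

theorem Closed.precondition_mem {A : Set α} (hA : N.Closed A) {b e : α} (hb : b ∈ N.B)
    (he : e ∈ A) (hbe : N.F b e) : b ∈ A := by
  rw [hA]
  intro y hy h
  rcases h with h | h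
  · by_cases hyb : y = b
    · exact hy e he (Or.inl (hyb ▸ le_of_F hbe))
    · exact hy e he (Or.inr (le_of_F_of_condition_le hb hbe h hyb))
  · exact hy e he (Or.inl (le_trans h (le_of_F hbe)))

/-- An element concurrent to a set that meets every relatedness class of a closed set `A`
lies below no element of `A`. -/
theorem Closed.not_le_of_mem_prime {A τ : Set α} (hA : N.Closed A) (hτA : τ ⊆ A)
    (hτ : ∀ a ∈ A, ∃ t ∈ τ, N.li a t) {x a : α} (hx : x ∈ N.prime τ) (ha : a ∈ A) :
    ¬ N.le x a := by
  intro hxa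
  induction hxa with
  | refl =>
    obtain ⟨t, ht, h⟩ := hτ x ha
    exact hx t ht h
  | @tail c a hxc hca ih =>
    refine ih ?_
    rcases N.bipartite c a hca with ⟨hc, -⟩ | ⟨-, haB⟩
    · exact hA.precondition_mem hc ha hca
    · have hxa : N.le x a := le_trans hxc (le_of_F hca)
      obtain ⟨t, ht, hat | hta⟩ := hτ a ha
      · exact absurd (Or.inl (le_trans hxa hat)) (hx t ht)
      · have hne : t ≠ a := fun h => hx t ht (Or.inl (h ▸ hxa))
        exact hA.mem_of_le_of_le (hτA ht) ha (le_of_F_of_le_condition haB hca hta hne)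
          (le_of_F hca)

theorem IsBCutOf.exists_li {A τ : Set α} (hτ : N.IsBCutOf A τ) {a : α} (ha : a ∈ A) :
    ∃ t ∈ τ, N.li a t := by
  obtain ⟨hτA, -, hco, hmax⟩ := hτ
  by_contra! h
  have hins : insert a τ = τ :=
    hmax _ (Set.insert_subset ha hτA)
      (hco.insert fun t ht _ => ⟨h t ht, co_symm (h t ht)⟩) (Set.subset_insert a τ)
  exact h a (hins ▸ Set.mem_insert a τ) (Or.inl (le_refl a))

end CausalNet

/-- In a locally finite, K-dense causal net, every closed set `A`
equals the closure `τ''` of any of its B-cuts `τ`. -/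
theorem closed_eq_bcut_closure {α : Type*} (N : CausalNet α)
    (hLF : N.LocallyFinite) (hK : N.KDense)
    (A τ : Set α) (hA : N.Closed A) (hτ : N.IsBCutOf A τ) :
    A = N.prime (N.prime τ) := by
  have hA' : N.reverse.Closed A := by rwa [CausalNet.Closed, N.reverse_prime]
  have hli : ∀ a ∈ A, ∃ t ∈ τ, N.li a t := fun a ha => hτ.exists_li ha
  have hli' : ∀ a ∈ A, ∃ t ∈ τ, N.reverse.li a t := fun a ha => by
    simpa only [CausalNet.li, N.reverse_le, or_comm] using hli a ha
  have hprime : N.prime τ ⊆ N.prime A := by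
    rintro x hx a ha (h | h)
    · exact hA.not_le_of_mem_prime hτ.1 hli hx ha h
    · exact hA'.not_le_of_mem_prime hτ.1 hli' (N.reverse_prime ▸ hx) ha (N.reverse_le.2 h)
  apply Set.Subset.antisymm
  · exact hA.subset.trans (CausalNet.prime_anti hprime)
  · exact (CausalNet.prime_anti (CausalNet.prime_anti hτ.1)).trans hA.symm.subset
end

section
/- Let N = (B,E,F) be a locally finite, K-dense causal net with X = B ∪ E. Let A ⊆ X be a closed set (A = A'') and let τ be a B-cut of A. Then for every x ∈ X, if x co y for all y ∈ τ, then x ∈ A' (i.e., x co z for every z ∈ A). -/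
namespace CausalNet

variable {α : Type*} (N : CausalNet α)

/-- A closed set is order convex. -/
theorem mem_of_between {A : Set α} (hA : N.Closed A) {x y z : α} (hx : x ∈ A) (hy : y ∈ A)
    (hxz : N.le x z) (hzy : N.le z y) : z ∈ A := by
  rw [hA]
  rintro w hw (h | h)
  · exact hw x hx (Or.inr (hxz.trans h))
  · exact hw y hy (Or.inl (h.trans hzy))

/-- A closed set contains every precondition of each of its events. -/
theorem mem_of_flow_to_mem {A : Set α} (hA : N.Closed A) {b e : α} (hb : b ∈ N.B)
    (hbe : N.F b e) (he : e ∈ A) : b ∈ A := by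
  rw [hA]
  rintro w hw (h | h)
  · rcases h.cases_head with rfl | ⟨e', hbe', hew⟩
    · exact hw e he (Or.inl (.single hbe))
    · obtain rfl : e' = e := N.succ_subsingleton b hb hbe' hbe
      exact hw e' he (Or.inr hew)
  · exact hw e he (Or.inl (h.tail hbe))

/-- A closed set contains every postcondition of each of its events. -/
theorem mem_of_flow_from_mem {A : Set α} (hA : N.Closed A) {b e : α} (hb : b ∈ N.B)
    (heb : N.F e b) (he : e ∈ A) : b ∈ A := by
  rw [hA]
  rintro w hw (h | h)
  · exact hw e he (Or.inr (h.head heb))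
  · rcases h.cases_tail with rfl | ⟨e', hwe, heb'⟩
    · exact hw e he (Or.inr (.single heb))
    · obtain rfl : e' = e := N.pred_subsingleton b hb heb' heb
      exact hw e' he (Or.inl hwe)

/-- Every element of `S` is causally related to some element of a B-cut of `S`. -/
theorem exists_li_of_mem {S τ : Set α} (hτ : N.IsBCutOf S τ) {z : α} (hz : z ∈ S) :
    ∃ y ∈ τ, N.li z y := by
  obtain ⟨hτS, -, hco, hmax⟩ := hτ
  by_contra! h
  have hm : insert z τ = τ := by
    refine hmax _ (Set.insert_subset hz hτS) ?_ (Set.subset_insert z τ)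
    exact hco.insert fun y hy _ => ⟨h y hy, fun hyz => h y hy hyz.symm⟩
  exact h z (hm ▸ Set.mem_insert z τ) (Or.inl .refl)

end CausalNet

/-- In a locally finite, K-dense causal net, if `τ` is a B-cut of a
closed set `A`, then any element concurrent with all of `τ` lies in `A'`. -/
theorem co_bcut_mem_prime {α : Type*} (N : CausalNet α)
    (hLF : N.LocallyFinite) (hK : N.KDense)
    (A τ : Set α) (hA : N.Closed A) (hτ : N.IsBCutOf A τ) :
    ∀ x : α, (∀ y ∈ τ, N.co x y) → x ∈ N.prime A := by
  intro x hx z hz hxz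
  have hxA : x ∉ A := fun h => by
    obtain ⟨y, hy, hxy⟩ := N.exists_li_of_mem hτ h
    exact hx y hy hxy
  rcases hxz with h | h
  · induction h with
    | refl => exact hxA hz
    | @tail c d hxc hcd ih =>
      refine ih ?_
      rcases N.bipartite c d hcd with ⟨hc, -⟩ | ⟨-, hd⟩
      · exact N.mem_of_flow_to_mem hA hc hcd hz
      · obtain ⟨y, hy, hdy | hyd⟩ := N.exists_li_of_mem hτ hz
        · exact absurd (Or.inl ((hxc.tail hcd).trans hdy)) (hx y hy)
        · rcases hyd.cases_tail with rfl | ⟨e, hye, hed⟩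
          · exact absurd (Or.inl (hxc.tail hcd)) (hx d hy)
          · obtain rfl : e = c := N.pred_subsingleton d hd hed hcd
            exact N.mem_of_between hA (hτ.1 hy) hz hye (.single hcd)
  · induction h using Relation.ReflTransGen.head_induction_on with
    | refl => exact hxA hz
    | @head d c hdc hcx ih =>
      refine ih ?_
      rcases N.bipartite d c hdc with ⟨hd, -⟩ | ⟨-, hc⟩
      · obtain ⟨y, hy, hdy | hyd⟩ := N.exists_li_of_mem hτ hz
        · rcases hdy.cases_head with rfl | ⟨e, hde, hey⟩
          · exact absurd (Or.inr (hcx.head hdc)) (hx d hy)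
          · obtain rfl : e = c := N.succ_subsingleton d hd hde hdc
            exact N.mem_of_between hA hz (hτ.1 hy) (.single hdc) hey
        · exact absurd (Or.inr (hyd.trans (hcx.head hdc))) (hx y hy)
      · exact N.mem_of_flow_from_mem hA hc hdc hz
end
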